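/- For q an odd prime power and any finite S₀ ⊆ 𝔽_qˣ, the group Γ_S is torsion-free: every element of Γ_S of finite order is the identity. -/

import Mathlib

open Polynomial Quaternion

noncomputable section

/-- The multiplicative set of `𝔽_q[t]` generated by `t` and `t - τ` for `τ ∈ S₀`. -/
def sden (F : Type) [Field F] (S₀ : Set F) : Submonoid F[X] :=
  Submonoid.closure ({X} ∪ (fun τ : F => X - C τ) '' S₀)

/-- The ring `o_S`, the localization of `𝔽_q[t]` inverting `t` and `t - τ` for `τ ∈ S₀`. -/
abbrev OS (F : Type) [Field F] (S₀ : Set F) := Localization (sden F S₀)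

/-- The quaternion algebra `ℍ[o_S, c, t]` with `i² = c`, `j² = t`, `ij = -ji = k`. -/
abbrev QAS (F : Type) [Field F] (S₀ : Set F) (c : F) : Type :=
  ℍ[OS F S₀, algebraMap F[X] (OS F S₀) (C c), algebraMap F[X] (OS F S₀) X]

/-- The central subgroup of scalar units. -/
def scalarUnits (R A : Type*) [CommRing R] [Ring A] [Algebra R A] : Subgroup Aˣ :=
  (Units.map (algebraMap R A).toMonoidHom).range

instance scalarUnits_normal (R A : Type*) [CommRing R] [Ring A] [Algebra R A] :
    (scalarUnits R A).Normal := by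
  constructor
  intro n hn g
  obtain ⟨r, rfl⟩ := hn
  refine ⟨r, ?_⟩
  ext
  simp only [Units.val_mul, Units.coe_map, RingHom.toMonoidHom_eq_coe, MonoidHom.coe_coe]
  rw [← Algebra.commutes (r : R) ((g : Aˣ) : A), mul_assoc, Units.mul_inv, mul_one]

/-- The group `Λ_S = ℍ[o_S, c, t]ˣ/o_Sˣ`. -/
abbrev LambdaS (F : Type) [Field F] (S₀ : Set F) (c : F) : Type :=
  (QAS F S₀ c)ˣ ⧸ scalarUnits (OS F S₀) (QAS F S₀ c)

/-- The class `[w]` of a unit `w`. -/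
abbrev clsS (F : Type) [Field F] (S₀ : Set F) (c : F) : (QAS F S₀ c)ˣ →* LambdaS F S₀ c :=
  QuotientGroup.mk' _

/-- The canonical map `F → o_S`. -/
def toOS (F : Type) [Field F] (S₀ : Set F) : F →+* OS F S₀ :=
  (algebraMap F[X] (OS F S₀)).comp (C : F →+* F[X])

/-- The quaternion `1 + α·j = 1 + x·j + y·k` for `α = x + y·√c ∈ 𝔽_{q²}`. -/
def oneAddJ (F : Type) [Field F] (S₀ : Set F) (c : F) (x y : F) : QAS F S₀ c :=
  ⟨1, 0, toOS F S₀ x, toOS F S₀ y⟩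

/-- `α = x + y·√c` in `𝔽_{q²} = F(√c)`. -/
def hasCoord (F : Type) [Field F] (E : Type) [Field E] [Algebra F E] (s : E)
    (α : E) (x y : F) : Prop :=
  α = algebraMap F E x + algebraMap F E y * s

/-- The set `PA_τ = {[1 + α·j] : α ∈ 𝔽_{q²}, N(α) = α^{q+1} = τ⁻¹} ⊆ Λ_S`. -/
def PASet (F : Type) [Field F] [Fintype F] (E : Type) [Field E] [Algebra F E] (s : E)
    (S₀ : Set F) (c : F) (τ : F) : Set (LambdaS F S₀ c) :=
  {z | ∃ (α : E) (x y : F) (w : (QAS F S₀ c)ˣ),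
    hasCoord F E s α x y ∧
    α ^ (Fintype.card F + 1) = algebraMap F E τ⁻¹ ∧
    (w : QAS F S₀ c) = oneAddJ F S₀ c x y ∧
    z = clsS F S₀ c w}

/-- The group `Γ_S`, generated by all `PA_τ`, `τ ∈ S₀`. -/
def GammaS (F : Type) [Field F] [Fintype F] (E : Type) [Field E] [Algebra F E] (s : E)
    (S₀ : Set F) (c : F) : Subgroup (LambdaS F S₀ c) :=
  Subgroup.closure (⋃ τ ∈ S₀, PASet F E s S₀ c τ)


/-- The ring homomorphism between quaternion algebras induced by a homomorphism of base rings. -/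
def quaternionMap {R S : Type*} [CommRing R] [CommRing S] (f : R →+* S) (a b : R) :
    ℍ[R, a, b] →+* ℍ[S, f a, f b] where
  toFun u := ⟨f u.re, f u.imI, f u.imJ, f u.imK⟩
  map_one' := by ext <;> simp
  map_zero' := by ext <;> simp
  map_add' u v := by ext <;> simp
  map_mul' u v := by ext <;> simp

theorem quaternionMap_star {R S : Type*} [CommRing R] [CommRing S] (f : R →+* S) (a b : R)
    (u : ℍ[R, a, b]) : quaternionMap f a b (star u) = star (quaternionMap f a b u) := by
  ext <;> simp [quaternionMap]

theorem quaternionMap_injective {R S : Type*} [CommRing R] [CommRing S] {f : R →+* S}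
    (hf : Function.Injective f) (a b : R) : Function.Injective (quaternionMap f a b) := by
  intro u v h
  ext
  · exact hf (congrArg QuaternionAlgebra.re h)
  · exact hf (congrArg QuaternionAlgebra.imI h)
  · exact hf (congrArg QuaternionAlgebra.imJ h)
  · exact hf (congrArg QuaternionAlgebra.imK h)

section Residue

variable {F : Type} [Field F] {c : F} {E : Type} [Field E] [Algebra F E] {s : E}

/-- Reduction of the quaternion algebra over `F[t]` modulo `j`: the residue ring at the ramified
place `t = 0` embeds in `E`. -/
def residueAtJ (hs : s ^ 2 = algebraMap F E c) : ℍ[F[X], C c, X] →+* E where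
  toFun u := algebraMap F E (u.re.eval 0) + algebraMap F E (u.imI.eval 0) * s
  map_one' := by simp
  map_zero' := by simp
  map_add' u v := by simp; ring
  map_mul' u v := by
    simp
    rw [← hs]
    ring

theorem eq_zero_of_sq_eq_mul_sq (hc : ¬IsSquare c) {x y : F} (h : x ^ 2 = c * y ^ 2) :
    x = 0 ∧ y = 0 := by
  by_cases hy : y = 0
  · subst hy
    simpa using h
  · exact (hc ⟨x / y, by field_simp; exact h.symm⟩).elim

theorem X_dvd_of_X_dvd_sq_sub (hc : ¬IsSquare c) {a b : F[X]} (h : X ∣ a ^ 2 - C c * b ^ 2) :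
    X ∣ a ∧ X ∣ b := by
  rw [X_dvd_iff, coeff_zero_eq_eval_zero] at *
  rw [X_dvd_iff, coeff_zero_eq_eval_zero]
  exact eq_zero_of_sq_eq_mul_sq hc (by simpa [sub_eq_zero] using h)

theorem X_pow_dvd_of_normForm_eq_zero (hc : ¬IsSquare c) (n : ℕ) :
    ∀ a b d e : F[X], a ^ 2 - C c * b ^ 2 = X * (d ^ 2 - C c * e ^ 2) →
      X ^ n ∣ a ∧ X ^ n ∣ b ∧ X ^ n ∣ d ∧ X ^ n ∣ e := by
  induction n with
  | zero => simp
  | succ n ih =>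
    intro a b d e h
    obtain ⟨⟨a, rfl⟩, ⟨b, rfl⟩⟩ := X_dvd_of_X_dvd_sq_sub hc ⟨_, h⟩
    have h₁ : d ^ 2 - C c * e ^ 2 = X * (a ^ 2 - C c * b ^ 2) :=
      mul_left_cancel₀ X_ne_zero (by linear_combination -h)
    obtain ⟨⟨d, rfl⟩, ⟨e, rfl⟩⟩ := X_dvd_of_X_dvd_sq_sub hc ⟨_, h₁⟩
    obtain ⟨ha, hb, hd, he⟩ := ih a b d e
      (mul_left_cancel₀ X_ne_zero (by linear_combination -h₁))
    simp only [pow_succ']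
    exact ⟨mul_dvd_mul_left _ ha, mul_dvd_mul_left _ hb, mul_dvd_mul_left _ hd,
      mul_dvd_mul_left _ he⟩

theorem eq_zero_of_forall_X_pow_dvd {a : F[X]} (h : ∀ n, X ^ n ∣ a) : a = 0 := by
  ext n
  exact X_pow_dvd_iff.mp (h (n + 1)) n n.lt_succ_self

theorem quaternion_eq_zero_of_star_mul_self (hc : ¬IsSquare c) {u : ℍ[F[X], C c, X]}
    (h : star u * u = 0) : u = 0 := by
  have hre := congrArg QuaternionAlgebra.re h
  simp at hre
  have key := fun n => X_pow_dvd_of_normForm_eq_zero hc n u.re u.imI u.imJ u.imK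
    (by linear_combination hre)
  ext1
  · exact eq_zero_of_forall_X_pow_dvd fun n => (key n).1
  · exact eq_zero_of_forall_X_pow_dvd fun n => (key n).2.1
  · exact eq_zero_of_forall_X_pow_dvd fun n => (key n).2.2.1
  · exact eq_zero_of_forall_X_pow_dvd fun n => (key n).2.2.2

theorem quaternion_noZeroDivisors (hc : ¬IsSquare c) : NoZeroDivisors ℍ[F[X], C c, X] where
  eq_zero_or_eq_zero_of_mul_eq_zero {u v} h := by
    by_contra! hne
    have hN : (star u * u).re ≠ 0 := fun h0 => hne.1 <|
      quaternion_eq_zero_of_star_mul_self hc (by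
        rw [QuaternionAlgebra.star_mul_eq_coe, h0, QuaternionAlgebra.coe_zero])
    have h₁ : (star u * u).re • v = 0 := by
      rw [← QuaternionAlgebra.coe_mul_eq_smul, ← QuaternionAlgebra.star_mul_eq_coe, mul_assoc, h,
        mul_zero]
    apply hne.2
    ext1
    · exact (mul_eq_zero.mp (congrArg QuaternionAlgebra.re h₁)).resolve_left hN
    · exact (mul_eq_zero.mp (congrArg QuaternionAlgebra.imI h₁)).resolve_left hN
    · exact (mul_eq_zero.mp (congrArg QuaternionAlgebra.imJ h₁)).resolve_left hN
    · exact (mul_eq_zero.mp (congrArg QuaternionAlgebra.imK h₁)).resolve_left hN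

/-- A quaternion congruent to `1` modulo `j` is determined up to conjugation by its powers. -/
theorem star_eq_of_star_pow_eq [Finite F] (hc : ¬IsSquare c) (hs : s ^ 2 = algebraMap F E c)
    {u : ℍ[F[X], C c, X]} (hu : residueAtJ hs u = 1) (hu' : residueAtJ hs (star u) = 1)
    {n : ℕ} (hn : n ≠ 0) (h : star u ^ n = u ^ n) : star u = u := by
  have := quaternion_noZeroDivisors hc
  obtain ⟨p, hp⟩ := CharP.exists F
  have hp_prime : Fact p.Prime := ⟨CharP.char_is_prime F p⟩
  have : CharP ℍ[F[X], C c, X] p :=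
    charP_of_injective_algebraMap (algebraMap F ℍ[F[X], C c, X]).injective p
  have : CharP E p := charP_of_injective_algebraMap (algebraMap F E).injective p
  obtain ⟨k, m, hm, rfl⟩ := Nat.exists_eq_pow_mul_and_not_dvd hn p hp_prime.out.ne_one
  have hcomm : Commute (star u) u := star_comm_self' u
  have h₁ : star u ^ m - u ^ m = 0 := by
    refine eq_zero_of_pow_eq_zero (n := p ^ k) ?_
    rw [sub_pow_char_pow_of_commute _ _ (hcomm.pow_pow m m), ← pow_mul, ← pow_mul,
      mul_comm m, h, sub_self]
  rw [← hcomm.geom_sum₂_mul, mul_eq_zero] at h₁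
  refine sub_eq_zero.mp (h₁.resolve_left fun h0 => hm ?_)
  have := congrArg (residueAtJ hs) h0
  simpa [hu, hu', CharP.cast_eq_zero_iff E p] using this

end Residue

theorem sden_le_nonZeroDivisors (F : Type) [Field F] (S₀ : Set F) :
    sden F S₀ ≤ nonZeroDivisors F[X] := by
  refine Submonoid.closure_le.mpr ?_
  rintro _ (rfl | ⟨τ, -, rfl⟩)
  · exact mem_nonZeroDivisors_of_ne_zero X_ne_zero
  · exact mem_nonZeroDivisors_of_ne_zero (X_sub_C_ne_zero τ)

theorem algebraMap_OS_injective (F : Type) [Field F] (S₀ : Set F) :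
    Function.Injective (algebraMap F[X] (OS F S₀)) :=
  IsLocalization.injective _ (sden_le_nonZeroDivisors F S₀)

theorem mem_scalarUnits_of_coe {R : Type*} [CommRing R] {a b : R} {w : ℍ[R, a, b]ˣ} {r : R}
    (h : (w : ℍ[R, a, b]) = r) : w ∈ scalarUnits R ℍ[R, a, b] := by
  have hr : r * (w⁻¹ : ℍ[R, a, b]ˣ).val.re = 1 := by
    have := congrArg QuaternionAlgebra.re w.mul_inv
    rw [h, QuaternionAlgebra.coe_mul_eq_smul] at this
    simpa using this
  refine ⟨Units.mkOfMulEqOne _ _ hr, ?_⟩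
  ext1
  exact h.symm

theorem star_eq_of_mem_scalarUnits {R : Type*} [CommRing R] {a b : R} {w : ℍ[R, a, b]ˣ}
    (h : w ∈ scalarUnits R ℍ[R, a, b]) : star (w : ℍ[R, a, b]) = w := by
  obtain ⟨r, rfl⟩ := h
  exact QuaternionAlgebra.star_coe _

/-- Every element of `Γ_S` is represented by a quaternion over `F[t]` congruent to `1` modulo
`j`, together with its conjugate. -/
theorem exists_residue_one_of_mem_GammaS (F : Type) [Field F] [Fintype F] (c : F)
    (E : Type) [Field E] [Algebra F E] (s : E) (hs : s ^ 2 = algebraMap F E c)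
    (S₀ : Set F) {g : LambdaS F S₀ c} (hg : g ∈ GammaS F E s S₀ c) :
    ∃ (w : (QAS F S₀ c)ˣ) (u : ℍ[F[X], C c, X]),
      (w : QAS F S₀ c) = quaternionMap (algebraMap F[X] (OS F S₀)) (C c) X u ∧
      residueAtJ hs u = 1 ∧ residueAtJ hs (star u) = 1 ∧ g = clsS F S₀ c w := by
  induction hg using Subgroup.closure_induction with
  | mem g hg =>
    simp only [Set.mem_iUnion] at hg
    obtain ⟨τ, -, α, x, y, w, -, -, hw, rfl⟩ := hg
    refine ⟨w, ⟨1, 0, C x, C y⟩, ?_, by simp [residueAtJ], by simp [residueAtJ], rfl⟩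
    rw [hw]
    ext <;> simp [oneAddJ, quaternionMap, toOS]
  | one => exact ⟨1, 1, by simp, by simp, by simp, by simp⟩
  | mul g h _ _ ihg ihh =>
    obtain ⟨w, u, hw, hu, hu', rfl⟩ := ihg
    obtain ⟨w', v, hw', hv, hv', rfl⟩ := ihh
    exact ⟨w * w', u * v, by simp [hw, hw'], by simp [hu, hv], by simp [hu', hv'], by simp⟩
  | inv g _ ih =>
    obtain ⟨w, u, hw, hu, hu', rfl⟩ := ih
    refine ⟨star w, star u, ?_, hu', by rwa [star_star], ?_⟩
    · rw [Units.coe_star, hw, quaternionMap_star]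
    · rw [inv_eq_iff_mul_eq_one, ← map_mul]
      refine (QuotientGroup.eq_one_iff _).mpr
        (mem_scalarUnits_of_coe (r := (w * star w : QAS F S₀ c).re) ?_)
      rw [Units.val_mul, Units.coe_star]
      exact QuaternionAlgebra.mul_star_eq_coe _

/-- For `q` an odd prime power and any finite `S₀ ⊆ 𝔽_qˣ`, the group `Γ_S`
is torsion-free: every element of `Γ_S` of finite order is the identity. -/
theorem gammaS_torsionFree
    (F : Type) [Field F] [Fintype F] (hq : Odd (Fintype.card F))
    (c : F) (hc : ¬IsSquare c)
    (E : Type) [Field E] [Algebra F E] (s : E)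
    (hs : s ^ 2 = algebraMap F E c)
    (hspan : ∀ α : E, ∃ x y : F, hasCoord F E s α x y)
    (S₀ : Set F) (hS₀ : (0 : F) ∉ S₀) :
    ∀ g : GammaS F E s S₀ c, IsOfFinOrder g → g = 1 := by
  rintro ⟨g, hg⟩ hfin
  obtain ⟨n, hn, hpow⟩ := isOfFinOrder_iff_pow_eq_one.mp hfin
  rw [Subtype.ext_iff] at hpow ⊢
  obtain ⟨w, u, hw, hu, hu', rfl⟩ := exists_residue_one_of_mem_GammaS F c E s hs S₀ hg
  have hmem : w ^ n ∈ scalarUnits (OS F S₀) (QAS F S₀ c) :=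
    (QuotientGroup.eq_one_iff _).mp hpow
  have hstar := star_eq_of_mem_scalarUnits hmem
  have hinj := quaternionMap_injective (algebraMap_OS_injective F S₀) (C c) X
  rw [Units.val_pow_eq_pow_val, hw, ← map_pow, ← quaternionMap_star, star_pow] at hstar
  have huu := star_eq_of_star_pow_eq hc hs hu hu' hn.ne' (hinj hstar)
  have htwo : (2 : F) ≠ 0 := Ring.two_ne_zero fun h => by
    have := FiniteField.even_card_of_char_two h
    rw [Nat.odd_iff] at hq
    omega
  have hneg : ∀ a : F[X], -a = a → a = 0 := fun a ha => by
    have h2 : C (2 : F) * a = 0 := by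
      rw [map_ofNat]
      linear_combination -ha
    exact (mul_eq_zero.mp h2).resolve_left (C_ne_zero.mpr htwo)
  have hI := hneg _ (by simpa using congrArg QuaternionAlgebra.imI huu)
  have hJ := hneg _ (by simpa using congrArg QuaternionAlgebra.imJ huu)
  have hK := hneg _ (by simpa using congrArg QuaternionAlgebra.imK huu)
  refine (QuotientGroup.eq_one_iff _).mpr
    (mem_scalarUnits_of_coe (r := algebraMap F[X] (OS F S₀) u.re) ?_)
  rw [hw]
  ext <;> simp [quaternionMap, hI, hJ, hK]
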